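/- Let G = C_n^r with n ≥ 3 and r ≥ 3, and let α_r ∈ [0, n-1] be the residue of -2^{r-1} modulo n. If α_r ≠ 0, then C_0(G) is contained in the interval [(2^r - 1)(n - 1) - α_r + 1, η(G) - 1]. -/

import Mathlib

/-- `S` contains a short zero-sum subsequence: a nonempty subsequence with sum `0`
whose length is at most `exp(G)`. -/
def HasShortZeroSumSubseq {G : Type*} [AddCommGroup G] (S : Multiset G) : Prop :=
  ∃ T, T ≤ S ∧ T.sum = 0 ∧ 1 ≤ Multiset.card T ∧ Multiset.card T ≤ AddMonoid.exponent G

/-- `η G` : the smallest `d` such that every sequence over `G` of length at least `d`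
contains a short zero-sum subsequence. -/
noncomputable def etaConst (G : Type*) [AddCommGroup G] : ℕ :=
  sInf {d : ℕ | ∀ S : Multiset G, d ≤ Multiset.card S → HasShortZeroSumSubseq S}

/-- `D G` : the Davenport constant, the smallest `d` such that every sequence over `G`
of length at least `d` contains a nonempty zero-sum subsequence. -/
noncomputable def davenport (G : Type*) [AddCommGroup G] : ℕ :=
  sInf {d : ℕ | ∀ S : Multiset G, d ≤ Multiset.card S → ∃ T, T ≤ S ∧ T ≠ 0 ∧ T.sum = 0}

/-- `C₀(G)` : the set of `t ∈ [D(G)+1, η(G)-1]` such that every zero-sum sequence over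
`G` of length exactly `t` contains a short zero-sum subsequence. -/
def C0 (G : Type*) [AddCommGroup G] : Set ℕ :=
  {t | davenport G + 1 ≤ t ∧ t ≤ etaConst G - 1 ∧
    ∀ S : Multiset G, Multiset.card S = t → S.sum = 0 → HasShortZeroSumSubseq S}

/-- The vectors of `C_n^k` all of whose coordinates are `0` or `1`. -/
noncomputable def cube (n k : ℕ) : Finset (Fin k → ZMod n) :=
  Fintype.piFinset fun _ => {0, 1}

lemma mem_cube {n k : ℕ} {x : Fin k → ZMod n} : x ∈ cube n k ↔ ∀ i, x i = 0 ∨ x i = 1 := by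
  simp [cube]

lemma zero_ne_one_zmod {n : ℕ} (hn : 2 ≤ n) : (0 : ZMod n) ≠ 1 :=
  have : Fact (1 < n) := ⟨hn⟩
  zero_ne_one

lemma card_cube {n k : ℕ} (hn : 2 ≤ n) : (cube n k).card = 2 ^ k := by
  simp [cube, Fintype.card_piFinset, Finset.card_pair (zero_ne_one_zmod hn)]

lemma card_cube_erase_zero {n k : ℕ} (hn : 2 ≤ n) : ((cube n k).erase 0).card = 2 ^ k - 1 := by
  rw [Finset.card_erase_of_mem (mem_cube.2 fun i => by simp), card_cube hn]

lemma sum_cube_apply {n k : ℕ} (hn : 2 ≤ n) (i : Fin k) :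
    ∑ x ∈ cube n k, x i = 2 ^ (k - 1) := by
  have h := Finset.prod_univ_sum (fun _ : Fin k => ({0, 1} : Finset (ZMod n)))
    (fun j y => if j = i then y else 1)
  simp only [Finset.sum_pair (zero_ne_one_zmod hn)] at h
  have h2 : ∀ x : Fin k → ZMod n, ∏ j, (if j = i then x j else 1) = x i := by
    intro x; simp
  simp only [h2] at h
  rw [cube, ← h, ← Finset.mul_prod_erase _ _ (Finset.mem_univ i), Finset.prod_congr rfl
    (g := fun _ => (2 : ZMod n))]
  · simp [Finset.card_erase_of_mem]
  · intro j hj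
    rw [if_neg (Finset.ne_of_mem_erase hj)]
    norm_num

lemma exists_le_card_eq {β : Type*} (S : Multiset β) {l : ℕ} (h : l ≤ Multiset.card S) :
    ∃ T ≤ S, Multiset.card T = l := by
  induction S using Quotient.inductionOn with
  | h L =>
    refine ⟨(L.take l : List β), ?_, ?_⟩
    · exact (List.take_sublist l L).subperm
    · simpa using h

lemma sum_apply_eq_countP {n k : ℕ} (hn : 2 ≤ n) (W : Multiset (Fin k → ZMod n))
    (hW : ∀ x ∈ W, x ∈ cube n k) (i : Fin k) :
    W.sum i = (W.countP (fun x => x i = 1) : ℕ) := by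
  induction W using Multiset.induction_on with
  | empty => simp
  | cons a W ih =>
    have h1 := ih fun x hx => hW x (Multiset.mem_cons_of_mem hx)
    rcases mem_cube.1 (hW a (Multiset.mem_cons_self a W)) i with h | h
    · rw [Multiset.sum_cons, Pi.add_apply, h1, h, zero_add, Multiset.countP_cons_of_neg]
      rw [h]; exact zero_ne_one_zmod hn
    · rw [Multiset.sum_cons, Pi.add_apply, h1, h, Multiset.countP_cons_of_pos (p := fun x => x i = 1) W h]
      push_cast; ring

lemma eq_of_sum_eq_zero {n k : ℕ} (hn : 2 ≤ n) {W : Multiset (Fin k → ZMod n)}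
    (hW : ∀ x ∈ W, x ∈ cube n k) (hsum : W.sum = 0) (hcard : Multiset.card W ≤ n) (i : Fin k) :
    (∀ x ∈ W, x i = 0) ∨ ((∀ x ∈ W, x i = 1) ∧ Multiset.card W = n) := by
  have h := sum_apply_eq_countP hn W hW i
  rw [hsum, Pi.zero_apply, eq_comm, ZMod.natCast_eq_zero_iff] at h
  have hle := Multiset.countP_le_card (fun x : Fin k → ZMod n => x i = 1) W
  rcases Nat.eq_zero_or_pos (W.countP fun x => x i = 1) with h0 | h0
  · left
    intro x hx
    exact (mem_cube.1 (hW x hx) i).resolve_right (Multiset.countP_eq_zero.1 h0 x hx)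
  · right
    have := Nat.le_of_dvd h0 h
    refine ⟨Multiset.countP_eq_card.1 (by omega), by omega⟩

/-- A multiset of cube vectors of multiplicity less than `n` has no zero-sum submultiset of
size `n`. -/
lemma sum_ne_zero_of_card_eq {n k : ℕ} (hn : 2 ≤ n) {W : Multiset (Fin k → ZMod n)}
    (hW : ∀ x ∈ W, x ∈ cube n k) (hc : ∀ x, W.count x ≤ n - 1) (hcard : Multiset.card W = n) :
    W.sum ≠ 0 := by
  intro hsum
  obtain ⟨a, ha⟩ := Multiset.card_pos_iff_exists_mem.1 (by omega : 0 < Multiset.card W)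
  have : W = Multiset.replicate (Multiset.card W) a := by
    rw [Multiset.eq_replicate_card]
    intro b hb
    funext i
    rcases eq_of_sum_eq_zero hn hW hsum hcard.le i with h | ⟨h, -⟩
    · rw [h a ha, h b hb]
    · rw [h a ha, h b hb]
  have h2 := hc a
  rw [this, Multiset.count_replicate_self] at h2
  omega

lemma sum_ne_zero_of_card_le {n k : ℕ} (hn : 2 ≤ n) {W : Multiset (Fin k → ZMod n)}
    (hW : ∀ x ∈ W, x ∈ (cube n k).erase 0) (hc : ∀ x, W.count x ≤ n - 1)
    (hpos : 1 ≤ Multiset.card W) (hcard : Multiset.card W ≤ n) : W.sum ≠ 0 := by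
  intro hsum
  have hW' : ∀ x ∈ W, x ∈ cube n k := fun x hx => Finset.mem_of_mem_erase (hW x hx)
  obtain ⟨a, ha⟩ := Multiset.card_pos_iff_exists_mem.1 hpos
  apply Finset.ne_of_mem_erase (hW a ha)
  funext i
  rcases eq_of_sum_eq_zero hn hW' hsum hcard i with h | ⟨-, h⟩
  · exact h a ha
  · exact absurd hsum (sum_ne_zero_of_card_eq hn hW' hc h)

lemma count_nsmul_val_le {β : Type*} [DecidableEq β] (U : Finset β) (m : ℕ) {W : Multiset β}
    (h : W ≤ m • U.val) (x : β) : W.count x ≤ m := by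
  refine (Multiset.count_le_of_le x h).trans ?_
  rw [Multiset.count_nsmul]
  exact (Nat.mul_le_mul_left m (Multiset.nodup_iff_count_le_one.1 U.nodup x)).trans (mul_one m).le

lemma mem_of_le_nsmul_val {β : Type*} {U : Finset β} {m : ℕ} {W : Multiset β}
    (h : W ≤ m • U.val) {x : β} (hx : x ∈ W) : x ∈ U :=
  Multiset.mem_of_mem_nsmul (Multiset.mem_of_le h hx)

/-- The difference of the first two coordinates. -/
def coordDiff (n m : ℕ) : (Fin (m + 2) → ZMod n) →+ ZMod n where
  toFun x := x 1 - x 0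
  map_zero' := by simp
  map_add' x y := by simp only [Pi.add_apply]; ring

lemma coordDiff_apply {n m : ℕ} (x : Fin (m + 2) → ZMod n) : coordDiff n m x = x 1 - x 0 := rfl

lemma map_sum_eq_card_nsmul {A B : Type*} [AddCommMonoid A] [AddCommMonoid B] (f : A →+ B)
    (W : Multiset A) (c : B) (h : ∀ x ∈ W, f x = c) : f W.sum = Multiset.card W • c := by
  rw [map_multiset_sum, Multiset.map_congr rfl h, Multiset.map_const', Multiset.sum_replicate]

/-- Every intermediate size is attained by a submultiset on which `coordDiff` sums to `1`. -/
lemma exists_le_coordDiff_sum_eq_one {n m : ℕ} (hn : 2 ≤ n) {U : Finset (Fin (m + 2) → ZMod n)}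
    (hU : U = cube n (m + 2) ∨ U = (cube n (m + 2)).erase 0) {l : ℕ} (hl : 1 ≤ l)
    (hl' : l + 1 ≤ (n - 1) * U.card) :
    ∃ S ≤ (n - 1) • U.val, Multiset.card S = l ∧ coordDiff n m S.sum = 1 := by
  have hUc : ∀ x ∈ U, x ∈ cube n (m + 2) := by
    rcases hU with rfl | rfl
    · exact fun x hx => hx
    · exact fun x hx => Finset.mem_of_mem_erase hx
  have hUm : ∀ x ∈ cube n (m + 2), x ≠ 0 → x ∈ U := by
    rcases hU with rfl | rfl
    · exact fun x hx _ => hx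
    · exact fun x hx h => Finset.mem_erase.2 ⟨h, hx⟩
  have h01 := zero_ne_one_zmod hn
  set P := U.filter fun x => x 0 = 0 ∧ x 1 = 1 with hP
  set N := U.filter fun x => x 0 = 1 ∧ x 1 = 0 with hN
  set Z := U.filter fun x => x 0 = x 1 with hZ
  have hcardPN : P.card = N.card := by
    let σ : Equiv.Perm (Fin (m + 2)) := Equiv.swap 0 1
    have hσ : ∀ x ∈ U, x ≠ 0 → x ∘ σ ∈ U := by
      intro x hx h
      refine hUm _ (mem_cube.2 fun i => mem_cube.1 (hUc x hx) _) fun h0 => h ?_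
      funext i
      have := congrFun h0 (σ i)
      simpa [σ] using this
    refine Finset.card_nbij' (fun x => x ∘ σ) (fun x => x ∘ σ) ?_ ?_ ?_ ?_
    · intro x hx
      have hx' := Finset.mem_filter.1 hx
      refine Finset.mem_filter.2 ⟨hσ x hx'.1 ?_, ?_⟩
      · rintro rfl; exact h01 hx'.2.2
      · simpa [σ, and_comm] using hx'.2
    · intro x hx
      have hx' := Finset.mem_filter.1 hx
      refine Finset.mem_filter.2 ⟨hσ x hx'.1 ?_, ?_⟩
      · rintro rfl; exact h01 hx'.2.1
      · simpa [σ, and_comm] using hx'.2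
    · intro x _; funext i; simp [σ]
    · intro x _; funext i; simp [σ]
  have hcard : U.card = P.card + N.card + Z.card := by
    have hPN : Disjoint P N := by
      rw [Finset.disjoint_filter]
      intro x _ h h'
      exact h01 (h.1.symm.trans h'.1)
    have hPNZ : Disjoint (P ∪ N) Z := by
      rw [Finset.disjoint_left]
      intro x h h'
      have h' := (Finset.mem_filter.1 h').2
      rcases Finset.mem_union.1 h with h | h
      · have h := (Finset.mem_filter.1 h).2
        exact h01 (by rw [← h.1, h', h.2])
      · have h := (Finset.mem_filter.1 h).2
        exact h01 (by rw [← h.1, h', h.2])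
    rw [← Finset.card_union_of_disjoint hPN, ← Finset.card_union_of_disjoint hPNZ]
    congr 1
    ext x
    simp only [Finset.mem_union, hP, hN, hZ, Finset.mem_filter]
    constructor
    · intro hx
      rcases mem_cube.1 (hUc x hx) 0 with h | h <;> rcases mem_cube.1 (hUc x hx) 1 with h' | h' <;>
        simp [hx, h, h']
    · tauto
  have hPpos : 0 < P.card := by
    refine Finset.card_pos.2 ⟨Pi.single 1 1, Finset.mem_filter.2 ⟨hUm _ ?_ ?_, ?_, ?_⟩⟩
    · refine mem_cube.2 fun i => ?_
      rw [Pi.single_apply]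
      split_ifs <;> simp
    · intro h
      have := congrFun h 1
      simp only [Pi.single_eq_same, Pi.zero_apply] at this
      exact h01 this.symm
    · simp
    · simp
  have hZpos : 0 < Z.card := by
    refine Finset.card_pos.2 ⟨1, Finset.mem_filter.2 ⟨hUm _ ?_ ?_, rfl⟩⟩
    · exact mem_cube.2 fun i => Or.inr rfl
    · intro h
      exact h01 (congrFun h 0).symm
  have hle : (n - 1) • P.val + (n - 1) • N.val + (n - 1) • Z.val ≤ (n - 1) • U.val := by
    rw [← nsmul_add, ← nsmul_add]
    refine nsmul_le_nsmul_right (le_of_eq ?_) _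
    refine Multiset.eq_of_le_of_card_le (Multiset.le_iff_count.2 fun x => ?_) ?_
    · simp only [Multiset.count_add, hP, hN, hZ, Finset.filter_val, Multiset.count_filter]
      by_cases h1 : x 0 = x 1
      · have h2 : ¬ (x 0 = 0 ∧ x 1 = 1) := fun h => h01 (by rw [← h.1, h1, h.2])
        have h3 : ¬ (x 0 = 1 ∧ x 1 = 0) := fun h => h01 (by rw [← h.1, h1, h.2])
        rw [if_pos h1, if_neg h2, if_neg h3]; omega
      · rw [if_neg h1]
        by_cases h2 : x 0 = 0
        · rw [if_neg (fun h : x 0 = 1 ∧ x 1 = 0 => h01 (h2.symm.trans h.1))]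
          split_ifs <;> omega
        · rw [if_neg (fun h : x 0 = 0 ∧ x 1 = 1 => h2 h.1)]
          split_ifs <;> omega
    · simp only [Multiset.card_add]
      exact hcard.le
  have hmul : (n - 1) * U.card = (n - 1) * P.card + (n - 1) * P.card + (n - 1) * Z.card := by
    rw [hcard, ← hcardPN]; ring
  have hPpos' : 0 < (n - 1) * P.card := Nat.mul_pos (by omega) hPpos
  have hZpos' : 0 < (n - 1) * Z.card := Nat.mul_pos (by omega) hZpos
  obtain ⟨a, b, ha, hb, hab⟩ : ∃ a b, a + 1 ≤ (n - 1) * P.card ∧ b ≤ (n - 1) * Z.card ∧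
      (a + 1) + a + b = l := by
    refine ⟨min ((n - 1) * P.card - 1) ((l - 1) / 2),
      l - 1 - 2 * min ((n - 1) * P.card - 1) ((l - 1) / 2), ?_, ?_, ?_⟩ <;> omega
  obtain ⟨P', hP', hPc⟩ := exists_le_card_eq ((n - 1) • P.val) (l := a + 1) (by simpa using ha)
  obtain ⟨N', hN', hNc⟩ := exists_le_card_eq ((n - 1) • N.val) (l := a)
    (by simp only [Multiset.card_nsmul, Finset.card_val, ← hcardPN]; omega)
  obtain ⟨Z', hZ', hZc⟩ := exists_le_card_eq ((n - 1) • Z.val) (l := b) (by simpa using hb)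
  refine ⟨P' + N' + Z', (add_le_add (add_le_add hP' hN') hZ').trans hle, ?_, ?_⟩
  · simp only [Multiset.card_add]; omega
  · simp only [Multiset.sum_add, map_add]
    rw [map_sum_eq_card_nsmul _ P' 1, map_sum_eq_card_nsmul _ N' (-1),
      map_sum_eq_card_nsmul _ Z' 0, hPc, hNc]
    · simp
    · intro x hx
      have := (Finset.mem_filter.1 (mem_of_le_nsmul_val hZ' hx)).2
      rw [coordDiff_apply, this, sub_self]
    · intro x hx
      have := (Finset.mem_filter.1 (mem_of_le_nsmul_val hN' hx)).2
      rw [coordDiff_apply, this.1, this.2, zero_sub]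
    · intro x hx
      have := (Finset.mem_filter.1 (mem_of_le_nsmul_val hP' hx)).2
      rw [coordDiff_apply, this.1, this.2, sub_zero]

/-- Gluing a multiset without short zero-sum submultisets with one without zero-sum submultisets
of size `n`, along an embedding of the latter into the affine hyperplane of vectors with leading
coordinate `1`. -/
lemma exists_glue {n m : ℕ} (hn : 2 ≤ n) {S T : Multiset (Fin (m + 2) → ZMod n)}
    (hS : S ≤ (n - 1) • ((cube n (m + 2)).erase 0).val) (hT : T ≤ (n - 1) • (cube n (m + 2)).val)
    (hSd : coordDiff n m S.sum = 1) (hTd : coordDiff n m T.sum = 1)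
    (hTn : n ∣ Multiset.card T) :
    ∃ V : Multiset (Fin (m + 2 + 1) → ZMod n), Multiset.card V = Multiset.card S + Multiset.card T ∧
      V.sum = 0 ∧ ∀ W ≤ V, 1 ≤ Multiset.card W → Multiset.card W ≤ n → W.sum ≠ 0 := by
  have h01 := zero_ne_one_zmod hn
  let lam := coordDiff n m
  let d := S.sum - T.sum
  have hd : lam d = 0 := by
    change coordDiff n m (S.sum - T.sum) = 0
    rw [map_sub, hSd, hTd, sub_self]
  have hsmul : ∀ (c : ZMod n) (x : Fin (m + 2) → ZMod n), lam (c • x) = c * lam x := by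
    intro c x
    simp only [lam, coordDiff_apply, Pi.smul_apply, smul_eq_mul]; ring
  let g : (Fin (m + 2) → ZMod n) →+ (Fin (m + 2) → ZMod n) :=
    { toFun := fun x => -(x + lam x • d)
      map_zero' := by simp
      map_add' := fun x y => by rw [map_add, add_smul]; abel }
  let g' : (Fin (m + 2) → ZMod n) →+ (Fin (m + 2) → ZMod n) :=
    { toFun := fun x => -x + lam x • d
      map_zero' := by simp
      map_add' := fun x y => by rw [map_add, add_smul]; abel }
  have hg : ∀ x, g x = -(x + lam x • d) := fun _ => rfl
  have hg' : ∀ x, g' x = -x + lam x • d := fun _ => rfl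
  have hgg : ∀ x, g' (g x) = x := by
    intro x
    rw [hg', hg, map_neg, map_add, hsmul, hd, mul_zero, add_zero, neg_smul]
    abel
  have hgT : g T.sum = -S.sum := by
    have : lam T.sum = 1 := hTd
    rw [hg, this, one_smul]
    simp [d]
  let tail : (Fin (m + 2 + 1) → ZMod n) →+ (Fin (m + 2) → ZMod n) :=
    { toFun := Fin.tail, map_zero' := rfl, map_add' := fun _ _ => rfl }
  let head : (Fin (m + 2 + 1) → ZMod n) →+ ZMod n := Pi.evalAddMonoidHom _ 0
  let inS : (Fin (m + 2) → ZMod n) → Fin (m + 2 + 1) → ZMod n := fun x => Fin.cons 0 x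
  let inT : (Fin (m + 2) → ZMod n) → Fin (m + 2 + 1) → ZMod n := fun x => Fin.cons 1 (g x)
  have hhS : ∀ x, head (inS x) = 0 := fun x => rfl
  have hhT : ∀ x, head (inT x) = 1 := fun x => rfl
  have htS : ∀ x, tail (inS x) = x := fun x => rfl
  have htT : ∀ x, tail (inT x) = g x := fun x => rfl
  have hext : ∀ x, head x = 0 → tail x = 0 → x = 0 := by
    intro x h1 h2
    funext i
    refine Fin.cases h1 (fun j => congrFun h2 j) i
  have hVS : (S.map inS + T.map inT).filter (fun x => head x = 0) = S.map inS := by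
    rw [Multiset.filter_add, Multiset.filter_eq_self.2, Multiset.filter_eq_nil.2, add_zero]
    · intro x hx
      obtain ⟨y, -, rfl⟩ := Multiset.mem_map.1 hx
      rw [hhT]; exact h01.symm
    · intro x hx
      obtain ⟨y, -, rfl⟩ := Multiset.mem_map.1 hx
      exact hhS y
  have hVT : (S.map inS + T.map inT).filter (fun x => ¬ head x = 0) = T.map inT := by
    rw [Multiset.filter_add, Multiset.filter_eq_nil.2, Multiset.filter_eq_self.2, zero_add]
    · intro x hx
      obtain ⟨y, -, rfl⟩ := Multiset.mem_map.1 hx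
      rw [hhT]; exact h01.symm
    · intro x hx
      obtain ⟨y, -, rfl⟩ := Multiset.mem_map.1 hx
      exact not_not.2 (hhS y)
  refine ⟨S.map inS + T.map inT, by simp, hext _ ?_ ?_, ?_⟩
  · rw [map_multiset_sum, Multiset.map_add, Multiset.map_map, Multiset.map_map]
    simp only [Function.comp_def, hhS, hhT, Multiset.map_const', Multiset.sum_add,
      Multiset.sum_replicate]
    simpa [ZMod.natCast_eq_zero_iff] using hTn
  · rw [map_multiset_sum, Multiset.map_add, Multiset.map_map, Multiset.map_map]
    simp only [Function.comp_def, htS, htT, Multiset.map_id', Multiset.sum_add]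
    rw [← map_multiset_sum, hgT, add_neg_cancel]
  · intro W hW hpos hle hsum
    have hWf := Multiset.filter_add_not (fun x => head x = 0) W
    set A := W.filter fun x => head x = 0 with hA
    set B := W.filter fun x => ¬ head x = 0 with hB
    have hAle : A ≤ S.map inS := hVS ▸ Multiset.filter_le_filter _ hW
    have hBle : B ≤ T.map inT := hVT ▸ Multiset.filter_le_filter _ hW
    have hA' : A.map tail ≤ S := by
      simpa [Multiset.map_map, Function.comp_def, htS] using Multiset.map_le_map hAle (f := tail)
    have hB' : B.map (fun x => g' (tail x)) ≤ T := by
      simpa [Multiset.map_map, Function.comp_def, htT, hgg] using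
        Multiset.map_le_map hBle (f := fun x => g' (tail x))
    have hcardAB : Multiset.card A + Multiset.card B = Multiset.card W := by
      rw [← hWf, Multiset.card_add]
    have hBn : n ∣ Multiset.card B := by
      rw [← ZMod.natCast_eq_zero_iff]
      have h := congrArg head hsum
      rw [← hWf, Multiset.sum_add, map_add, map_zero, map_sum_eq_card_nsmul head A 0,
        map_sum_eq_card_nsmul head B 1] at h
      · simpa using h
      · intro x hx
        obtain ⟨y, -, rfl⟩ := Multiset.mem_map.1 (Multiset.mem_of_le hBle hx)
        exact hhT y
      · intro x hx
        obtain ⟨y, -, rfl⟩ := Multiset.mem_map.1 (Multiset.mem_of_le hAle hx)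
        exact hhS y
    rcases Nat.eq_zero_or_pos (Multiset.card B) with h0 | h0
    · have hAW : A = W := by
        rw [Multiset.card_eq_zero.1 h0, add_zero] at hWf
        exact hWf
      rw [hAW] at hA'
      refine sum_ne_zero_of_card_le hn (fun x hx => mem_of_le_nsmul_val (hA'.trans hS) hx)
        (count_nsmul_val_le _ _ (hA'.trans hS)) (by simpa using hpos) (by simpa using hle) ?_
      rw [← map_multiset_sum, hsum, map_zero]
    · have := Nat.le_of_dvd h0 hBn
      have hA0 : Multiset.card A = 0 := by omega
      have hBW : B = W := by
        rw [Multiset.card_eq_zero.1 hA0, zero_add] at hWf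
        exact hWf
      rw [hBW] at hB'
      refine sum_ne_zero_of_card_eq hn (fun x hx => mem_of_le_nsmul_val (hB'.trans hT) hx)
        (count_nsmul_val_le _ _ (hB'.trans hT)) (by rw [Multiset.card_map]; omega) ?_
      have h : (W.map fun x => g' (tail x)) = W.map (g'.comp tail) := rfl
      rw [h, ← map_multiset_sum, hsum, map_zero]

/-- The multiset of all nonzero cube vectors with multiplicity `n - 1`, less `α` copies of the
all-ones vector, has sum zero for the right residue `α`. -/
lemma exists_extremal {n k α : ℕ} (hn : 2 ≤ n) (hk : 1 ≤ k) (hα : α ≤ n - 1)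
    (hα_cong : (α : ZMod n) = -(2 ^ (k - 1) : ZMod n)) :
    ∃ V : Multiset (Fin k → ZMod n), Multiset.card V = (2 ^ k - 1) * (n - 1) - α ∧
      V.sum = 0 ∧ ∀ W ≤ V, 1 ≤ Multiset.card W → Multiset.card W ≤ n → W.sum ≠ 0 := by
  set F := (n - 1) • ((cube n k).erase 0).val with hF
  have h1 : (1 : Fin k → ZMod n) ∈ (cube n k).erase 0 := by
    refine Finset.mem_erase.2 ⟨fun h => ?_, mem_cube.2 fun i => Or.inr rfl⟩
    exact zero_ne_one_zmod hn (congrFun h ⟨0, hk⟩).symm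
  have hR : Multiset.replicate α (1 : Fin k → ZMod n) ≤ F := by
    rw [← Multiset.le_count_iff_replicate_le, hF, Multiset.count_nsmul,
      Multiset.count_eq_one_of_mem (Finset.nodup _) h1]
    omega
  have hadd := tsub_add_cancel_of_le hR
  refine ⟨F - Multiset.replicate α 1, ?_, ?_, ?_⟩
  · rw [Multiset.card_sub hR, Multiset.card_replicate, hF, Multiset.card_nsmul, Finset.card_val,
      card_cube_erase_zero hn, mul_comm]
  · have hsum := congrArg Multiset.sum hadd
    rw [Multiset.sum_add, Multiset.sum_replicate, hF, Multiset.sum_nsmul] at hsum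
    have hcube : ((cube n k).erase 0).val.sum = ∑ x ∈ cube n k, x := by
      rw [Finset.sum_val, ← Finset.sum_erase (cube n k) (f := fun x => x) rfl]
      rfl
    rw [hcube] at hsum
    funext i
    have hi := congrFun hsum i
    rw [Pi.add_apply, Pi.smul_apply, Pi.smul_apply, Finset.sum_apply, sum_cube_apply hn] at hi
    simp only [nsmul_eq_mul, Pi.one_apply, mul_one, hα_cong,
      Nat.cast_sub (by omega : 1 ≤ n), ZMod.natCast_self, Nat.cast_one] at hi
    rw [Pi.zero_apply]
    linear_combination hi
  · intro W hW hpos hle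
    have hWF := hW.trans (tsub_le_self : F - _ ≤ F)
    exact sum_ne_zero_of_card_le hn (fun x hx => mem_of_le_nsmul_val hWF hx)
      (count_nsmul_val_le _ _ hWF) hpos hle

lemma exists_zero_sum_of_card_le {n m α t : ℕ} (hn : 3 ≤ n) (hα : α ≤ n - 1)
    (hα_cong : (α : ZMod n) = -(2 ^ (m + 2) : ZMod n)) (hα_ne : α ≠ 0) (ht : n + 1 ≤ t)
    (ht' : t ≤ (2 ^ (m + 3) - 1) * (n - 1) - α) :
    ∃ V : Multiset (Fin (m + 3) → ZMod n), Multiset.card V = t ∧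
      V.sum = 0 ∧ ∀ W ≤ V, 1 ≤ Multiset.card W → Multiset.card W ≤ n → W.sum ≠ 0 := by
  rcases ht'.eq_or_lt with rfl | hlt
  · exact exists_extremal (by omega) (by omega) hα hα_cong
  have hn2 : 2 ≤ n := by omega
  obtain ⟨c, hc⟩ : ∃ c, (n - 1) * 2 ^ m = c := ⟨_, rfl⟩
  have hcpos : n - 1 ≤ c := hc ▸ Nat.le_mul_of_pos_right _ (by positivity)
  have hF0 : (n - 1) * (cube n (m + 2)).card = 4 * c := by
    rw [card_cube hn2, ← hc]; ring
  have hF1 : (n - 1) * ((cube n (m + 2)).erase 0).card = 4 * c - (n - 1) := by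
    rw [card_cube_erase_zero hn2, Nat.mul_sub, mul_one, ← hc]; congr 1; ring
  have hM : (2 ^ (m + 3) - 1) * (n - 1) = 8 * c - (n - 1) := by
    rw [Nat.sub_mul, one_mul, ← hc]; congr 1; ring
  rw [hM] at hlt
  obtain ⟨u, l, hu, hu1, hu2, hl1, hl2, hul⟩ : ∃ u l, n ∣ u ∧ 1 ≤ u ∧
      u + 1 ≤ 4 * c ∧ 1 ≤ l ∧ l + 1 ≤ 4 * c - (n - 1) ∧ l + u = t := by
    by_cases h : t - n + 1 ≤ 4 * c - (n - 1)
    · exact ⟨n, t - n, dvd_rfl, by omega, by omega, by omega, by omega, by omega⟩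
    · refine ⟨4 * c - α, t - (4 * c - α), ?_, by omega, by omega, by omega, by omega, by omega⟩
      rw [← ZMod.natCast_eq_zero_iff, Nat.cast_sub (by omega), ← hc, hα_cong]
      push_cast [Nat.cast_sub (by omega : 1 ≤ n), ZMod.natCast_self]
      ring
  obtain ⟨S, hS, hSc, hSd⟩ := exists_le_coordDiff_sum_eq_one hn2 (Or.inr rfl) hl1 (hF1 ▸ hl2)
  obtain ⟨T, hT, hTc, hTd⟩ := exists_le_coordDiff_sum_eq_one hn2 (Or.inl rfl) hu1 (hF0 ▸ hu2)
  obtain ⟨V, hV, hV'⟩ := exists_glue hn2 hS hT hSd hTd (hTc ▸ hu)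
  exact ⟨V, by omega, hV'⟩

lemma exponent_pi_zmod_le {n r : ℕ} (hn : 1 ≤ n) : AddMonoid.exponent (Fin r → ZMod n) ≤ n := by
  refine Nat.le_of_dvd hn (AddMonoid.exponent_dvd_of_forall_nsmul_eq_zero fun g => ?_)
  funext i
  simp

lemma exists_zero_sum_of_card_large {G : Type*} [AddCommGroup G] [Finite G] {n : ℕ} (hn : 1 ≤ n)
    (hG : ∀ g : G, n • g = 0) :
    ∃ d : ℕ, ∀ S : Multiset G, d ≤ Multiset.card S → ∃ T, T ≤ S ∧ T ≠ 0 ∧ T.sum = 0 := by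
  classical
  have := Fintype.ofFinite G
  refine ⟨Fintype.card G * n, fun S hS => ?_⟩
  obtain ⟨x, hx⟩ : ∃ x, n ≤ S.count x := by
    by_contra! h
    rw [← Multiset.sum_count_eq_card (s := Finset.univ) (m := S) (by simp)] at hS
    have := Finset.sum_lt_sum_of_nonempty (s := (Finset.univ : Finset G)) ⟨0, Finset.mem_univ 0⟩
      (f := fun x => S.count x) (g := fun _ => n) fun x _ => h x
    rw [Finset.sum_const, Finset.card_univ, smul_eq_mul] at this
    omega
  refine ⟨Multiset.replicate n x, Multiset.le_count_iff_replicate_le.1 hx, fun h => ?_, ?_⟩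
  · have := congrArg Multiset.card h
    simp at this
    omega
  · rw [Multiset.sum_replicate, hG]

lemma le_davenport {n r : ℕ} (hn : 2 ≤ n) (hr : 1 ≤ r) : n ≤ davenport (Fin r → ZMod n) := by
  have : NeZero n := ⟨by omega⟩
  refine le_csInf (exists_zero_sum_of_card_large (n := n) (by omega) fun g => ?_) ?_
  · funext i
    simp
  · intro d hd
    by_contra! hlt
    obtain ⟨T, hT, hT0, hTs⟩ := hd (Multiset.replicate (n - 1) 1)
      (by rw [Multiset.card_replicate]; omega)
    obtain ⟨m, hm, rfl⟩ := Multiset.le_replicate_iff.1 hT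
    rw [Multiset.sum_replicate] at hTs
    have h := congrFun hTs ⟨0, hr⟩
    simp only [Pi.smul_apply, Pi.one_apply, nsmul_eq_mul, mul_one, Pi.zero_apply] at h
    rw [ZMod.natCast_eq_zero_iff] at h
    rcases Nat.eq_zero_or_pos m with rfl | h0
    · exact hT0 rfl
    · have := Nat.le_of_dvd h0 h
      omega

theorem stmt_11 (n r α : ℕ) (hn : 3 ≤ n) (hr : 3 ≤ r)
    (hα_lt : α ≤ n - 1) (hα_cong : (α : ZMod n) = -(2 ^ (r - 1) : ZMod n))
    (hα_ne : α ≠ 0) :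
    C0 (Fin r → ZMod n) ⊆
      Set.Icc ((2 ^ r - 1) * (n - 1) - α + 1) (etaConst (Fin r → ZMod n) - 1) := by
  rintro t ⟨ht1, ht2, hshort⟩
  refine ⟨?_, ht2⟩
  by_contra! hlt
  have hD := le_davenport (n := n) (r := r) (by omega) (by omega)
  obtain ⟨m, rfl⟩ : ∃ m, r = m + 3 := ⟨r - 3, by omega⟩
  obtain ⟨V, hVc, hVs, hV⟩ := exists_zero_sum_of_card_le (t := t) hn hα_lt hα_cong hα_ne
    (by omega) (by omega)
  obtain ⟨W, hW, hWs, hW1, hW2⟩ := hshort V hVc hVs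
  exact hV W hW hW1 (hW2.trans (exponent_pi_zmod_le (by omega))) hWs
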